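/- arXiv:1606.03862 — 2 statements merged into one kernel-verified Lean document; each statement's English description precedes it below -/
import Mathlib

section
/- Let M be a finitely generated conical refinement monoid and let p ∈ M be a free prime. Then the abelian group G'_p is generated as a semigroup by elements of the form p + g, where either g is a free prime of M with ḡ < p̄, or g belongs to the archimedean component of some regular prime q of M with q̄ < p̄. -/
namespace ArPardo

/-- A countable row-finite directed graph `E = (E⁰, E¹, s, r)`. -/
structure RowFiniteGraph : Type 1 where
  V : Type
  E : Type
  countableV : Countable V
  countableE : Countable E
  s : E → V
  r : E → V
  rowFinite : ∀ v : V, {e : E | s e = v}.Finite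

/-- The defining relations of the graph monoid, as a relation on the free
commutative monoid `V →₀ ℕ` on the vertices: for every vertex `v` emitting
at least one edge, `a_v = Σ_{e ∈ s⁻¹(v)} a_{r(e)}`. -/
def graphRel (G : RowFiniteGraph) (x y : G.V →₀ ℕ) : Prop :=
  ∃ v : G.V, (∃ e : G.E, G.s e = v) ∧ x = Finsupp.single v 1 ∧
    y = ∑ e ∈ (G.rowFinite v).toFinset, Finsupp.single (G.r e) 1

/-- The graph monoid `M(E)`: the quotient of the free commutative monoid on the
vertices by the congruence generated by the graph relations. -/
def graphMonoid (G : RowFiniteGraph) : Type :=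
  (addConGen (graphRel G)).Quotient

noncomputable instance (G : RowFiniteGraph) : AddCommMonoid (graphMonoid G) :=
  inferInstanceAs (AddCommMonoid (addConGen (graphRel G)).Quotient)

/-- The canonical generator `a_v` of the graph monoid. -/
noncomputable def vertexElem (G : RowFiniteGraph) (v : G.V) : graphMonoid G :=
  (addConGen (graphRel G)).mk' (Finsupp.single v 1)

/-- A commutative monoid is a graph monoid if it is isomorphic to `M(E)` for some
(countable) row-finite directed graph `E`. -/
def IsGraphMonoid (M : Type) [AddCommMonoid M] : Prop :=
  ∃ G : RowFiniteGraph, Nonempty (M ≃+ graphMonoid G)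

/-- The algebraic preorder on a commutative monoid: `x ≤ y` iff `y = x + z`. -/
def algLE {M : Type} [AddCommMonoid M] (x y : M) : Prop :=
  ∃ z : M, y = x + z

/-- A commutative monoid is conical if `x + y = 0` implies `x = y = 0`. -/
def IsConical (M : Type) [AddCommMonoid M] : Prop :=
  ∀ x y : M, x + y = 0 → x = 0 ∧ y = 0

/-- The Riesz refinement property. -/
def IsRefinement (M : Type) [AddCommMonoid M] : Prop :=
  ∀ a b c d : M, a + b = c + d →
    ∃ w x y z : M, a = w + x ∧ b = y + z ∧ c = w + y ∧ d = x + z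

/-- A prime element: not invertible, and `p ≤ a + b` implies `p ≤ a` or `p ≤ b`. -/
def IsPrimeElem {M : Type} [AddCommMonoid M] (p : M) : Prop :=
  (∀ q : M, p + q ≠ 0) ∧ ∀ a b : M, algLE p (a + b) → algLE p a ∨ algLE p b

/-- A free element: `n • p ≤ m • p` implies `n ≤ m`. -/
def IsFreeElem {M : Type} [AddCommMonoid M] (p : M) : Prop :=
  ∀ n m : ℕ, algLE (n • p) (m • p) → n ≤ m

/-- A regular element: `2x ≤ x`. -/
def IsRegularElem {M : Type} [AddCommMonoid M] (x : M) : Prop :=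
  algLE (x + x) x

/-- `q̄ < p̄` in the poset of (classes of) elements: `q ≤ p` and `p ≰ q`. -/
def classLT {M : Type} [AddCommMonoid M] (q p : M) : Prop :=
  algLE q p ∧ ¬ algLE p q

/-- `q` is a prime whose class lies in the lower cover of the class of the prime `p`:
`q̄ < p̄` and no prime class lies strictly between. -/
def InLowerCover {M : Type} [AddCommMonoid M] (p q : M) : Prop :=
  IsPrimeElem q ∧ classLT q p ∧
    ¬ ∃ t : M, IsPrimeElem t ∧ classLT q t ∧ classLT t p

/-- `Q` is a (finite) set of representatives of the classes in the lower cover of `p̄`: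
its elements are in the lower cover, pairwise inequivalent, and every prime in the
lower cover is equivalent to one of them. -/
def IsLowerCoverReps {M : Type} [AddCommMonoid M] (p : M) (Q : Finset M) : Prop :=
  (∀ q ∈ Q, InLowerCover p q) ∧
  (∀ q ∈ Q, ∀ q' ∈ Q, algLE q q' → algLE q' q → q = q') ∧
  (∀ t : M, InLowerCover p t → ∃ q ∈ Q, algLE q t ∧ algLE t q)

/-- The underlying set of the group `G'_p = {p + α : α ∈ M, p + α ≤ p}`. -/
def GpSet {M : Type} [AddCommMonoid M] (p : M) : Set M :=
  {y | ∃ α : M, y = p + α ∧ algLE y p}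

/-- `j : G' → M` realizes the abelian group `G'` as the group
`G'_p = {p + α : p + α ≤ p}` with identity `p` and operation
`(p + α) ∘ (p + β) = p + (α + β)`. -/
structure GpStructure (M : Type) [AddCommMonoid M] (p : M)
    (G' : Type) [AddCommGroup G'] (j : G' → M) : Prop where
  inj : Function.Injective j
  range_eq : Set.range j = GpSet p
  map_zero : j 0 = p
  map_add : ∀ (u v : G') (α β : M), j u = p + α → j v = p + β → j (u + v) = p + (α + β)

/-- The archimedean component of `s`: all `a` with `a ≤ n • s` and `s ≤ m • a` for
some positive integers `n, m`; it is a subsemigroup. -/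
def archComp {M : Type} [AddCommMonoid M] (s : M) : AddSubsemigroup M where
  carrier := {a : M | ∃ n m : ℕ, 0 < n ∧ 0 < m ∧ algLE a (n • s) ∧ algLE s (m • a)}
  add_mem' := by
    rintro a b ⟨n, m, hn, hm, ⟨z, hz⟩, ⟨w, hw⟩⟩ ⟨n', m', hn', hm', ⟨z', hz'⟩, ⟨w', hw'⟩⟩
    refine ⟨n + n', m, Nat.add_pos_left hn _, hm, ⟨z + z', ?_⟩, ⟨w + m • b, ?_⟩⟩
    · rw [add_nsmul, hz, hz']; abel
    · rw [nsmul_add, hw]; abel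

/-- `(Γ, ι)` is a Grothendieck group of the commutative semigroup `S`: every
semigroup homomorphism from `S` to an abelian group factors uniquely through `ι`. -/
def IsGrothendieck (S : Type) [Add S] (Γ : Type) [AddCommGroup Γ] (ι : AddHom S Γ) : Prop :=
  ∀ (A : Type) [AddCommGroup A], ∀ f : AddHom S A, ∃! g : Γ →+ A, ∀ x : S, g (ι x) = f x

/-- The almost-isomorphism condition at a free prime `p`, with `Q` a set of
representatives of the lower cover of `p̄`, and `s_p = Σ_{q ∈ Q} q`: for every
Grothendieck group `ι : M_{J_p} → Γ` of the archimedean component `M_{J_p}` of `s_p`,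
every realization `(G', j)` of the group `G'_p`, every incarnation
`φp : M_{J_p} → G'` of the map `x ↦ p + x`, the unique group homomorphism
`ψ = G(φ_p) : Γ → G'` with `ψ ∘ ι = φp` is surjective and its kernel is the cyclic
subgroup generated by `ι x` for some `x ∈ M_{J_p}`. -/
def AlmostIsoCondition (M : Type) [AddCommMonoid M] (p : M) (Q : Finset M) : Prop :=
  ∀ (Γ : Type) [AddCommGroup Γ],
    ∀ ι : AddHom (archComp (∑ q ∈ Q, (q : M))) Γ,
    IsGrothendieck (archComp (∑ q ∈ Q, (q : M))) Γ ι →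
    ∀ (G' : Type) [AddCommGroup G'], ∀ j : G' → M, GpStructure M p G' j →
    ∀ φp : AddHom (archComp (∑ q ∈ Q, (q : M))) G',
      (∀ a : archComp (∑ q ∈ Q, (q : M)), j (φp a) = p + (a : M)) →
    ∀ ψ : Γ →+ G', (∀ a, ψ (ι a) = φp a) →
      Function.Surjective ψ ∧
        ∃ x : archComp (∑ q ∈ Q, (q : M)), ψ.ker = AddSubgroup.zmultiples (ι x)

/-- An order-ideal of a commutative monoid. -/
def IsOrderIdeal {M : Type} [AddCommMonoid M] (S : Set M) : Prop :=
  (0 : M) ∈ S ∧ (∀ x y : M, x ∈ S → y ∈ S → x + y ∈ S) ∧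
    ∀ x y : M, algLE x y → y ∈ S → x ∈ S

/-- The order-ideal generated by a subset: the smallest order-ideal containing it. -/
def orderIdealGen {M : Type} [AddCommMonoid M] (X : Set M) : Set M :=
  ⋂₀ {S : Set M | IsOrderIdeal S ∧ X ⊆ S}

/-- The restriction graph `E_H` of a hereditary subset `H` of the vertices. -/
def restrictGraph (G : RowFiniteGraph) (H : Set G.V)
    (hher : ∀ e : G.E, G.s e ∈ H → G.r e ∈ H) : RowFiniteGraph where
  V := ↥H
  E := {e : G.E // G.s e ∈ H}
  countableV := by have := G.countableV; exact inferInstance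
  countableE := by have := G.countableE; exact inferInstance
  s := fun e => ⟨G.s e.1, e.2⟩
  r := fun e => ⟨G.r e.1, hher e.1 e.2⟩
  rowFinite := fun v => by
    have hsub : {e : {e : G.E // G.s e ∈ H} | (⟨G.s e.1, e.2⟩ : ↥H) = v}
        ⊆ Subtype.val ⁻¹' {e : G.E | G.s e = (v : G.V)} := by
      intro e he
      simpa [Subtype.ext_iff] using he
    exact Set.Finite.subset
      (Set.Finite.preimage (Subtype.val_injective.injOn) (G.rowFinite (v : G.V))) hsub

section AlgLE

variable {M : Type} [AddCommMonoid M]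

theorem algLE_refl (x : M) : algLE x x := ⟨0, (add_zero x).symm⟩

theorem algLE.trans {x y z : M} (hxy : algLE x y) (hyz : algLE y z) : algLE x z := by
  obtain ⟨a, rfl⟩ := hxy
  obtain ⟨b, rfl⟩ := hyz
  exact ⟨a + b, add_assoc x a b⟩

theorem algLE_add_right (x y : M) : algLE x (x + y) := ⟨y, rfl⟩

theorem algLE_add_left (x y : M) : algLE x (y + x) := ⟨y, add_comm y x⟩

theorem algLE.add {x y z w : M} (hxy : algLE x y) (hzw : algLE z w) :
    algLE (x + z) (y + w) := by
  obtain ⟨a, rfl⟩ := hxy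
  obtain ⟨b, rfl⟩ := hzw
  exact ⟨a + b, add_add_add_comm x a z b⟩

theorem nsmul_algLE_nsmul (x : M) {n m : ℕ} (h : n ≤ m) : algLE (n • x) (m • x) :=
  ⟨(m - n) • x, by rw [← add_nsmul, Nat.add_sub_cancel' h]⟩

/-- The algebraic preorder of a finitely generated commutative monoid is a well-quasi-order. -/
theorem wellQuasiOrdered_algLE [AddMonoid.FG M] : WellQuasiOrdered (algLE : M → M → Prop) := by
  obtain ⟨s, hs⟩ := AddMonoid.FG.fg_top (M := M)
  let f : (fun a b : s → ℕ ↦ a ≤ b) →r (algLE : M → M → Prop) :=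
    ⟨fun a ↦ ∑ i, a i • (i : M), fun {a b} hab ↦ ⟨∑ i, (b i - a i) • (i : M), by
      rw [← Finset.sum_add_distrib]
      exact Finset.sum_congr rfl fun i _ ↦ by rw [← add_nsmul, Nat.add_sub_cancel' (hab i)]⟩⟩
  refine WellQuasiOrdered.of_surjective wellQuasiOrdered_le f fun x ↦ ?_
  have hx : x ∈ AddSubmonoid.closure (s : Set M) := hs ▸ AddSubmonoid.mem_top x
  obtain ⟨a, ha⟩ := AddSubmonoid.mem_closure_finset'.1 hx
  exact ⟨a, ha.symm⟩

theorem wellFounded_classLT [AddMonoid.FG M] : WellFounded (classLT : M → M → Prop) := by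
  have : IsPreorder M algLE :=
    { refl := algLE_refl
      trans := fun _ _ _ ↦ algLE.trans }
  exact wellQuasiOrdered_algLE.wellFounded

/-- Riesz decomposition. -/
theorem IsRefinement.exists_eq_add_of_algLE_add (href : IsRefinement M) {x a b : M}
    (h : algLE x (a + b)) : ∃ a' b', x = a' + b' ∧ algLE a' a ∧ algLE b' b := by
  obtain ⟨z, hz⟩ := h
  obtain ⟨w, x', y, z', rfl, rfl, hx, -⟩ := href a b x z hz
  exact ⟨w, y, hx, algLE_add_right w x', algLE_add_right y z'⟩

/-- A finitely generated conical refinement monoid is primely generated. -/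
theorem IsRefinement.closure_isPrimeElem_eq_top [AddMonoid.FG M] (hcon : IsConical M)
    (href : IsRefinement M) : AddSubmonoid.closure {q : M | IsPrimeElem q} = ⊤ := by
  refine (AddSubmonoid.eq_top_iff' _).2 fun x ↦ ?_
  refine wellFounded_classLT.induction (C := (· ∈ AddSubmonoid.closure {q : M | IsPrimeElem q})) x
    fun x ih ↦ ?_
  by_cases hx : IsPrimeElem x
  · exact AddSubmonoid.subset_closure hx
  by_cases hx0 : x = 0
  · exact hx0 ▸ zero_mem _
  have hdecomp : ∃ a b, algLE x (a + b) ∧ ¬ algLE x a ∧ ¬ algLE x b := by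
    by_contra! h
    exact hx ⟨fun q hq ↦ hx0 (hcon x q hq).1,
      fun a b hab ↦ or_iff_not_imp_left.2 (h a b hab)⟩
  obtain ⟨a, b, hab, ha, hb⟩ := hdecomp
  obtain ⟨a', b', rfl, ha', hb'⟩ := href.exists_eq_add_of_algLE_add hab
  exact add_mem (ih a' ⟨algLE_add_right a' b', fun h ↦ ha (h.trans ha')⟩)
    (ih b' ⟨algLE_add_left b' a', fun h ↦ hb (h.trans hb')⟩)

theorem IsPrimeElem.nsmul_eq_add (href : IsRefinement M) {p : M} (hp : IsPrimeElem p) (n : ℕ) :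
    ∀ x y : M, n • p = x + y → ∃ i k, i + k = n ∧ algLE (i • p) x ∧ algLE (k • p) y := by
  induction n with
  | zero => exact fun x y _ ↦ ⟨0, 0, rfl, ⟨x, by simp⟩, ⟨y, by simp⟩⟩
  | succ n ih =>
    intro x y hxy
    rw [succ_nsmul'] at hxy
    obtain ⟨w, x', y', z', hpw, hnp, rfl, rfl⟩ := href _ _ _ _ hxy
    obtain ⟨i, k, rfl, hi, hk⟩ := ih y' z' hnp
    rcases hp.2 w x' (hpw ▸ algLE_refl p) with h | h
    · exact ⟨i + 1, k, by ring, succ_nsmul' p i ▸ h.add hi,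
        hk.trans (algLE_add_left z' x')⟩
    · exact ⟨i, k + 1, by ring, hi.trans (algLE_add_left y' w),
        succ_nsmul' p k ▸ h.add hk⟩

/-- In a refinement monoid every prime element is free or regular. -/
theorem IsPrimeElem.isFreeElem_or_isRegularElem (href : IsRefinement M) {p : M}
    (hp : IsPrimeElem p) : IsFreeElem p ∨ IsRegularElem p := by
  refine or_iff_not_imp_right.2 fun hreg n m ↦ ?_
  induction m generalizing n with
  | zero =>
    rintro ⟨z, hz⟩
    by_contra! hn
    obtain ⟨k, rfl⟩ := Nat.exists_eq_add_one.2 hn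
    exact hp.1 (k • p + z) (by rw [← add_assoc, ← succ_nsmul', ← hz, zero_nsmul])
  | succ m ih =>
    intro h
    rw [succ_nsmul'] at h
    obtain ⟨x, y, hxy, hx, hy⟩ := href.exists_eq_add_of_algLE_add h
    obtain ⟨i, k, rfl, hi, hk⟩ := hp.nsmul_eq_add href n x y hxy
    have hkm : k ≤ m := ih k (hk.trans hy)
    have hi1 : i ≤ 1 := by
      by_contra! hi2
      have h2 : algLE (2 • p) p := (nsmul_algLE_nsmul p hi2).trans (hi.trans hx)
      exact hreg (by rwa [two_nsmul] at h2)
    lia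

theorem self_mem_archComp (q : M) : q ∈ archComp q :=
  ⟨1, 1, one_pos, one_pos, by simpa using algLE_refl q, by simpa using algLE_refl q⟩

theorem IsFreeElem.not_add_self_algLE {p : M} (hp : IsFreeElem p) : ¬ algLE (p + p) p :=
  fun h ↦ absurd (hp 2 1 (by simpa [two_nsmul] using h)) (by decide)

theorem GpStructure.exists_eq_of_algLE {p : M} {G' : Type} [AddCommGroup G'] {j : G' → M}
    (hj : GpStructure M p G' j) {α : M} (h : algLE (p + α) p) : ∃ u, j u = p + α := by
  have : p + α ∈ Set.range j := hj.range_eq ▸ ⟨α, rfl, h⟩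
  exact this

theorem GpStructure.algLE_self {p : M} {G' : Type} [AddCommGroup G'] {j : G' → M}
    (hj : GpStructure M p G' j) (u : G') : algLE (j u) p := by
  have : j u ∈ GpSet p := hj.range_eq ▸ Set.mem_range_self u
  exact this.choose_spec.2

end AlgLE

/-- Let `M` be a finitely generated conical refinement monoid and
`p` a free prime of `M`. Then the abelian group `G'_p` (realized by any `(G', j)` as
in `GpStructure`) is generated, as a monoid under its group operation, by the
elements of the form `p + g` where either `g` is a free prime of `M` with `ḡ < p̄`,
or `g` belongs to the archimedean component of some regular prime `q` of `M` with
`q̄ < p̄`. -/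
theorem Gp_generated_by_primes_below (M : Type) [AddCommMonoid M] [AddMonoid.FG M]
    (hcon : IsConical M) (href : IsRefinement M)
    (p : M) (hprime : IsPrimeElem p) (hfree : IsFreeElem p) :
    ∀ (G' : Type) [AddCommGroup G'], ∀ j : G' → M, GpStructure M p G' j →
      AddSubmonoid.closure {u : G' | ∃ g : M, j u = p + g ∧
        ((IsPrimeElem g ∧ IsFreeElem g ∧ classLT g p) ∨
          (∃ q : M, IsPrimeElem q ∧ IsRegularElem q ∧ classLT q p ∧
            g ∈ archComp q))} = ⊤ := by
  intro G' _ j hj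
  suffices h : ∀ α ∈ AddSubmonoid.closure {q : M | IsPrimeElem q}, ∀ u : G', j u = p + α →
      u ∈ AddSubmonoid.closure {u : G' | ∃ g : M, j u = p + g ∧
        ((IsPrimeElem g ∧ IsFreeElem g ∧ classLT g p) ∨
          (∃ q : M, IsPrimeElem q ∧ IsRegularElem q ∧ classLT q p ∧ g ∈ archComp q))} by
    refine (AddSubmonoid.eq_top_iff' _).2 fun u ↦ ?_
    have hu : j u ∈ GpSet p := hj.range_eq ▸ Set.mem_range_self u
    obtain ⟨α, hα, -⟩ := hu
    exact h α (href.closure_isPrimeElem_eq_top hcon ▸ AddSubmonoid.mem_top α) u hα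
  intro α hα
  induction hα using AddSubmonoid.closure_induction with
  | mem q hq =>
    intro u hu
    have hle : algLE (p + q) p := hu ▸ hj.algLE_self u
    have hlt : classLT q p := ⟨(algLE_add_left q p).trans hle,
      fun h ↦ hfree.not_add_self_algLE (((algLE_refl p).add h).trans hle)⟩
    refine AddSubmonoid.subset_closure ⟨q, hu, ?_⟩
    rcases hq.isFreeElem_or_isRegularElem href with hq' | hq'
    · exact Or.inl ⟨hq, hq', hlt⟩
    · exact Or.inr ⟨q, hq, hq', hlt, self_mem_archComp q⟩
  | zero =>
    intro u hu
    have hu0 : u = 0 := hj.inj (by rw [hu, add_zero, hj.map_zero])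
    exact hu0 ▸ zero_mem _
  | add α β _ _ ihα ihβ =>
    intro u hu
    have hle : algLE (p + (α + β)) p := hu ▸ hj.algLE_self u
    obtain ⟨v, hv⟩ := hj.exists_eq_of_algLE
      (((algLE_refl p).add (algLE_add_right α β)).trans hle)
    obtain ⟨w, hw⟩ := hj.exists_eq_of_algLE
      (((algLE_refl p).add (algLE_add_left β α)).trans hle)
    have huvw : u = v + w := hj.inj (by rw [hu, hj.map_add v w α β hv hw])
    exact huvw ▸ add_mem (ihα v hv) (ihβ w hw)

end ArPardo
end

section
/- The commutative monoid M = ⟨p, a, b ∣ p = p + a, p = p + b⟩, i.e. the quotient of the free commutative monoid on {p, a, b} by the congruence generated by the relations p = p + a and p = p + b, is a finitely generated conical refinement monoid which is not a graph monoid: M is not isomorphic to M(E) for any row-finite directed graph E. -/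
namespace ArPardo

/-- The defining relations of the monoid `⟨p, a, b ∣ p = p + a, p = p + b⟩`, on the
free commutative monoid on three generators `p = 0`, `a = 1`, `b = 2`. -/
def pabRel (x y : Fin 3 →₀ ℕ) : Prop :=
  (x = Finsupp.single (0 : Fin 3) 1 ∧
    y = Finsupp.single (0 : Fin 3) 1 + Finsupp.single (1 : Fin 3) 1) ∨
  (x = Finsupp.single (0 : Fin 3) 1 ∧
    y = Finsupp.single (0 : Fin 3) 1 + Finsupp.single (2 : Fin 3) 1)

/-- The monoid `M = ⟨p, a, b ∣ p = p + a, p = p + b⟩`. -/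
def Mpab : Type := (addConGen pabRel).Quotient

noncomputable instance : AddCommMonoid Mpab :=
  inferInstanceAs (AddCommMonoid (addConGen pabRel).Quotient)

/-! ### The monoid `⟨p, a, b ∣ p = p + a, p = p + b⟩` -/

/-- Two words agree when they have the same degree in `p`, and coincide if this degree is `0`. -/
def pabCon : AddCon (Fin 3 →₀ ℕ) where
  r x y := x 0 = y 0 ∧ (x 0 = 0 → x = y)
  iseqv := by
    refine ⟨fun _ => ⟨rfl, fun _ => rfl⟩, fun h => ⟨h.1.symm, fun h0 => (h.2 (h.1.trans h0)).symm⟩,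
      fun h h' => ⟨h.1.trans h'.1, fun h0 => (h.2 h0).trans (h'.2 (h.1.symm.trans h0))⟩⟩
  add' := by
    rintro w x y z ⟨h1, h2⟩ ⟨h3, h4⟩
    refine ⟨by simp [h1, h3], fun h => ?_⟩
    simp only [Finsupp.add_apply, Nat.add_eq_zero_iff] at h
    rw [h2 h.1, h4 h.2]

theorem pabCon_iff {x y : Fin 3 →₀ ℕ} : pabCon x y ↔ x 0 = y 0 ∧ (x 0 = 0 → x = y) := Iff.rfl

theorem addConGen_single_zero (n i j : ℕ) :
    addConGen pabRel (Finsupp.single 0 (n + 1))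
      (Finsupp.single 0 (n + 1) + Finsupp.single 1 i + Finsupp.single 2 j) := by
  set C := addConGen pabRel
  have ha : C (Finsupp.single 0 1) (Finsupp.single 0 1 + Finsupp.single 1 1) :=
    AddConGen.Rel.of _ _ (Or.inl ⟨rfl, rfl⟩)
  have hb : C (Finsupp.single 0 1) (Finsupp.single 0 1 + Finsupp.single 2 1) :=
    AddConGen.Rel.of _ _ (Or.inr ⟨rfl, rfl⟩)
  have hai : ∀ i : ℕ, C (Finsupp.single 0 1) (Finsupp.single 0 1 + Finsupp.single 1 i) := by
    intro i
    induction i with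
    | zero => simpa using C.refl _
    | succ k ih =>
      have h := C.trans ha (C.add ih (C.refl (Finsupp.single 1 1)))
      rwa [add_assoc, ← Finsupp.single_add] at h
  have hbj : ∀ j : ℕ, C (Finsupp.single 0 1) (Finsupp.single 0 1 + Finsupp.single 2 j) := by
    intro j
    induction j with
    | zero => simpa using C.refl _
    | succ k ih =>
      have h := C.trans hb (C.add ih (C.refl (Finsupp.single 2 1)))
      rwa [add_assoc, ← Finsupp.single_add] at h
  have h := C.add (C.refl (Finsupp.single 0 n))
    (C.trans (hbj j) (C.add (hai i) (C.refl (Finsupp.single 2 j))))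
  rwa [← add_assoc, ← add_assoc, ← Finsupp.single_add] at h

theorem addConGen_pabRel : addConGen pabRel = pabCon := by
  apply le_antisymm
  · refine AddCon.addConGen_le.2 ?_
    rintro x y (⟨rfl, rfl⟩ | ⟨rfl, rfl⟩) <;> simp [pabCon_iff]
  · have key : ∀ (x : Fin 3 →₀ ℕ) (n : ℕ), x 0 = n + 1 →
        addConGen pabRel (Finsupp.single 0 (n + 1)) x := by
      intro x n hn
      convert addConGen_single_zero n (x 1) (x 2)
      ext i
      fin_cases i <;> simp [hn]
    intro x y h
    obtain ⟨h1, h2⟩ := pabCon_iff.1 h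
    rcases hx : x 0 with _ | n
    · rw [h2 hx]
      exact (addConGen pabRel).refl y
    · exact (addConGen pabRel).trans ((addConGen pabRel).symm (key x n hx))
        (key y n (h1 ▸ hx))

/-- The class in `Mpab` of a word in the generators. -/
noncomputable def pabMk : (Fin 3 →₀ ℕ) →+ Mpab := (addConGen pabRel).mk'

theorem pabMk_surjective : Function.Surjective pabMk := AddCon.mk'_surjective

theorem pabMk_eq_iff {x y : Fin 3 →₀ ℕ} :
    pabMk x = pabMk y ↔ x 0 = y 0 ∧ (x 0 = 0 → x = y) := by
  rw [← pabCon_iff, ← addConGen_pabRel]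
  exact (addConGen pabRel).eq

theorem Mpab_fg : AddMonoid.FG Mpab :=
  have : AddMonoid.FG (Fin 3 →₀ ℕ) := Module.Finite.iff_addMonoid_fg.1 inferInstance
  AddMonoid.fg_of_surjective pabMk pabMk_surjective

theorem Mpab_isConical : IsConical Mpab := by
  intro x y h
  obtain ⟨x, rfl⟩ := pabMk_surjective x
  obtain ⟨y, rfl⟩ := pabMk_surjective y
  rw [← map_add, ← map_zero pabMk, pabMk_eq_iff] at h
  have h0 := h.2 h.1
  rw [add_eq_zero] at h0
  simp [h0.1, h0.2]

/-- Refinement in one coordinate: an equation is only required where the corresponding weight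
(`A`, `B`, `C` or `D`) vanishes. -/
theorem exists_refinement_nat {A B C D : ℕ} (h : A + B = C + D) {a b c d : ℕ}
    (h' : A + B = 0 → a + b = c + d) :
    ∃ w x y z : ℕ, (A = 0 → a = w + x) ∧ (B = 0 → b = y + z) ∧
      (C = 0 → c = w + y) ∧ (D = 0 → d = x + z) := by
  by_cases h0 : A + B = 0
  · have := h' h0
    exact ⟨min a c, a - min a c, c - min a c, b - (c - min a c), by omega, by omega, by omega,
      by omega⟩
  by_cases hA : A = 0
  · by_cases hC : C = 0
    · exact ⟨0, a, c, 0, by omega, by omega, by omega, by omega⟩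
    · exact ⟨a, 0, 0, d, by omega, by omega, by omega, by omega⟩
  · by_cases hC : C = 0
    · exact ⟨c, 0, 0, b, by omega, by omega, by omega, by omega⟩
    · exact ⟨0, d, b, 0, by omega, by omega, by omega, by omega⟩

theorem Mpab_isRefinement : IsRefinement Mpab := by
  intro a b c d h
  obtain ⟨a, rfl⟩ := pabMk_surjective a
  obtain ⟨b, rfl⟩ := pabMk_surjective b
  obtain ⟨c, rfl⟩ := pabMk_surjective c
  obtain ⟨d, rfl⟩ := pabMk_surjective d
  rw [← map_add, ← map_add, pabMk_eq_iff] at h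
  obtain ⟨h0, h1⟩ := h
  simp only [Finsupp.add_apply] at h0 h1
  obtain ⟨W, X, Y, Z, hW, hX, hY, hZ⟩ :=
    exists_refinement_nat (A := 0) (B := 0) (C := 0) (D := 0) rfl (fun _ => h0)
  have hi : ∀ i, a 0 + b 0 = 0 → a i + b i = c i + d i := fun i h => DFunLike.congr_fun (h1 h) i
  choose w x y z hw hx hy hz using fun i => exists_refinement_nat h0 (hi i)
  let q (N : ℕ) (f : Fin 3 → ℕ) : Fin 3 →₀ ℕ :=
    Finsupp.equivFunOnFinite.symm fun i => if i = 0 then N else f i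
  have key : ∀ (u : Fin 3 →₀ ℕ) (N N' : ℕ) (f f' : Fin 3 → ℕ), u 0 = N + N' →
      (∀ i, u 0 = 0 → u i = f i + f' i) → pabMk u = pabMk (q N f) + pabMk (q N' f') := by
    intro u N N' f f' hN hf
    rw [← map_add, pabMk_eq_iff]
    refine ⟨by simp [q, hN], fun hu => Finsupp.ext fun i => ?_⟩
    by_cases hi : i = 0
    · simp [q, hi, hN]
    · simp [q, hi, hf i hu]
  exact ⟨pabMk (q W w), pabMk (q X x), pabMk (q Y y), pabMk (q Z z),
    key a W X w x (hW rfl) hw, key b Y Z y z (hX rfl) hx, key c W Y w y (hY rfl) hy,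
    key d X Z x z (hZ rfl) hz⟩

/-! ### Potentials along orbits -/

section Potential

variable {V : Type*} (n : V → V)

/-- The sum of `c` over the first `k` points of the orbit of `x`. -/
def orbitSum {A : Type*} [AddCommMonoid A] (c : V → A) (k : ℕ) (x : V) : A :=
  ∑ i ∈ Finset.range k, c (n^[i] x)

variable {n}

theorem orbitSum_add {A : Type*} [AddCommMonoid A] (c : V → A) (k l : ℕ) (x : V) :
    orbitSum n c (k + l) x = orbitSum n c k x + orbitSum n c l (n^[k] x) := by
  unfold orbitSum
  rw [Finset.sum_range_add]
  congr 1
  refine Finset.sum_congr rfl fun i _ => ?_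
  rw [add_comm k i, Function.iterate_add_apply]

theorem orbitSum_one {A : Type*} [AddCommMonoid A] (c : V → A) (x : V) :
    orbitSum n c 1 x = c x := by
  simp [orbitSum]

theorem exists_potential (c : V → ℤ) (w : V)
    (H : ∀ k l, n^[k] w = n^[l] w → orbitSum n c k w = orbitSum n c l w) :
    ∃ g : V → ℤ, ∀ v, (∃ k l, n^[k] v = n^[l] w) → g v = g (n v) + c v := by
  classical
  have wd : ∀ v k l k' l', k ≤ k' → n^[k] v = n^[l] w → n^[k'] v = n^[l'] w →
      orbitSum n c k v - orbitSum n c l w = orbitSum n c k' v - orbitSum n c l' w := by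
    intro v k l k' l' hk h h'
    obtain ⟨t, rfl⟩ := Nat.exists_eq_add_of_le hk
    have e : n^[l + t] w = n^[l'] w := by
      rw [← h', add_comm l t, add_comm k t, Function.iterate_add_apply,
        Function.iterate_add_apply, h]
    have := H _ _ e
    rw [orbitSum_add] at this ⊢
    rw [h, ← this]
    ring
  have wd' : ∀ v k l k' l', n^[k] v = n^[l] w → n^[k'] v = n^[l'] w →
      orbitSum n c k v - orbitSum n c l w = orbitSum n c k' v - orbitSum n c l' w := by
    intro v k l k' l' h h'
    rcases le_total k k' with hk | hk
    · exact wd v k l k' l' hk h h'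
    · exact (wd v k' l' k l hk h' h).symm
  have ex : ∀ v, ∃ x : ℤ, ∀ k l, n^[k] v = n^[l] w →
      x = orbitSum n c k v - orbitSum n c l w := by
    intro v
    by_cases hv : ∃ k l, n^[k] v = n^[l] w
    · obtain ⟨k, l, h⟩ := hv
      exact ⟨_, fun k' l' h' => wd' v k l k' l' h h'⟩
    · exact ⟨0, fun k l h => absurd ⟨k, l, h⟩ hv⟩
  choose g hg using ex
  refine ⟨g, ?_⟩
  rintro v ⟨k, l, h⟩
  have h1 : n^[1 + k] v = n^[l + 1] w := by
    rw [Function.iterate_add_apply, Function.iterate_succ_apply', h,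
      Function.iterate_succ_apply', Function.iterate_zero_apply]
  have h2 : n^[k] (n v) = n^[l + 1] w := by
    rw [← h1, add_comm, Function.iterate_succ_apply]
  rw [hg v _ _ h1, hg (n v) _ _ h2, orbitSum_add c 1 k, orbitSum_one]
  simp only [Function.iterate_one]
  ring

/-- After replacing a point by a point of its orbit, some nonzero linear functional of the weights
has no holonomy. -/
theorem exists_functional (c : V → ℤ × ℤ) (v : V) :
    ∃ (m : ℕ) (l₁ l₂ : ℤ), ¬ (l₁ = 0 ∧ l₂ = 0) ∧ ∀ k l, n^[k] (n^[m] v) = n^[l] (n^[m] v) →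
      orbitSum n (fun x => l₁ * (c x).1 + l₂ * (c x).2) k (n^[m] v) =
        orbitSum n (fun x => l₁ * (c x).1 + l₂ * (c x).2) l (n^[m] v) := by
  classical
  by_cases hinj : Function.Injective fun k => n^[k] v
  · refine ⟨0, 1, 0, by simp, fun k l h => ?_⟩
    rw [hinj h]
  have hper : ∃ m d, 0 < d ∧ n^[d] (n^[m] v) = n^[m] v := by
    have : ∃ i j, i < j ∧ n^[i] v = n^[j] v := by
      simp only [Function.Injective, not_forall] at hinj
      obtain ⟨i, j, h, hne⟩ := hinj
      rcases lt_or_gt_of_ne hne with hlt | hlt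
      · exact ⟨i, j, hlt, h⟩
      · exact ⟨j, i, hlt, h.symm⟩
    obtain ⟨i, j, hlt, h⟩ := this
    refine ⟨i, j - i, by omega, ?_⟩
    rw [← Function.iterate_add_apply, Nat.sub_add_cancel hlt.le, h]
  obtain ⟨m, hper⟩ := hper
  set w := n^[m] v
  let d := Nat.find hper
  have hd0 : 0 < d := (Nat.find_spec hper).1
  have hd : n^[d] w = w := (Nat.find_spec hper).2
  have hl : ∃ l₁ l₂ : ℤ, ¬ (l₁ = 0 ∧ l₂ = 0) ∧
      l₁ * (orbitSum n c d w).1 + l₂ * (orbitSum n c d w).2 = 0 := by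
    by_cases h : (orbitSum n c d w).1 = 0 ∧ (orbitSum n c d w).2 = 0
    · exact ⟨1, 0, by simp, by simp [h.1]⟩
    · refine ⟨(orbitSum n c d w).2, -(orbitSum n c d w).1, fun h' => h ⟨?_, h'.1⟩, by ring⟩
      linarith [h'.2]
  obtain ⟨l₁, l₂, hne, hl⟩ := hl
  refine ⟨m, l₁, l₂, hne, ?_⟩
  set c' : V → ℤ := fun x => l₁ * (c x).1 + l₂ * (c x).2
  have hSd : orbitSum n c' d w = 0 := by
    rw [← hl]
    simp [orbitSum, c', Finset.sum_add_distrib, Finset.mul_sum, Prod.fst_sum, Prod.snd_sum]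
  have hloop : ∀ k, n^[k] w = w → orbitSum n c' k w = 0 := by
    intro k
    induction k using Nat.strong_induction_on with
    | _ k ih =>
      intro hk
      rcases Nat.eq_zero_or_pos k with rfl | hk0
      · simp [orbitSum]
      · have hdk : d ≤ k := Nat.find_min' hper ⟨hk0, hk⟩
        obtain ⟨t, rfl⟩ := Nat.exists_eq_add_of_le hdk
        rw [add_comm, Function.iterate_add_apply, hd] at hk
        rw [orbitSum_add, hd, hSd, ih t (by omega) hk, add_zero]
  intro k l h
  have hk : n^[k + (k * d - k)] w = w := by
    have : k ≤ k * d := Nat.le_mul_of_pos_right k hd0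
    rw [Nat.add_sub_cancel' this, mul_comm, Function.iterate_mul]
    exact Function.iterate_fixed hd k
  have hl' : n^[l + (k * d - k)] w = w := by
    rw [add_comm, Function.iterate_add_apply, ← h, ← Function.iterate_add_apply, add_comm, hk]
  have e1 := hloop _ hk
  have e2 := hloop _ hl'
  rw [orbitSum_add] at e1 e2
  rw [h] at e1
  linarith

end Potential

/-! ### `Mpab` is not a graph monoid -/

/-- The congruence on `ℕ × ℤ` collapsing all the elements of degree at least two. -/
def truncCon : AddCon (ℕ × ℤ) where
  r x y := x = y ∨ (2 ≤ x.1 ∧ 2 ≤ y.1)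
  iseqv := by
    refine ⟨fun _ => Or.inl rfl, ?_, ?_⟩
    · rintro x y (rfl | h)
      · exact Or.inl rfl
      · exact Or.inr h.symm
    · rintro x y z (rfl | h) (rfl | h')
      · exact Or.inl rfl
      · exact Or.inr h'
      · exact Or.inr h
      · exact Or.inr ⟨h.1, h'.2⟩
  add' := by
    rintro w x y z (rfl | h) (rfl | h')
    · exact Or.inl rfl
    all_goals
      right
      simp only [Prod.fst_add]
      omega

theorem truncCon_iff {x y : ℕ × ℤ} : truncCon x y ↔ x = y ∨ (2 ≤ x.1 ∧ 2 ≤ y.1) := Iff.rfl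

section Graph

variable {G : RowFiniteGraph}

/-- The class in the graph monoid of a formal sum of vertices. -/
noncomputable def graphMk (G : RowFiniteGraph) : (G.V →₀ ℕ) →+ graphMonoid G :=
  (addConGen (graphRel G)).mk'

theorem graphMk_surjective : Function.Surjective (graphMk G) := AddCon.mk'_surjective

theorem graphMk_single (v : G.V) (k : ℕ) :
    graphMk G (Finsupp.single v k) = k • vertexElem G v := by
  rw [← Finsupp.smul_single_one, map_nsmul]
  rfl

theorem vertexElem_eq_sum {v : G.V} (hv : ∃ e, G.s e = v) :
    vertexElem G v = ∑ e ∈ (G.rowFinite v).toFinset, vertexElem G (G.r e) := by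
  have h : addConGen (graphRel G) (Finsupp.single v 1)
      (∑ e ∈ (G.rowFinite v).toFinset, Finsupp.single (G.r e) 1) :=
    AddConGen.Rel.of _ _ ⟨v, hv, rfl, rfl⟩
  have h' := (addConGen (graphRel G)).eq.2 h
  exact h'.trans (map_sum (graphMk G) _ _)

/-- A vertex weight compatible with a congruence on the target is compatible with all the identities
of the graph monoid. -/
theorem con_of_graphMk_eq {N : Type*} [AddCommMonoid N] (C : AddCon N) (f : G.V → N)
    (hf : ∀ v, (∃ e, G.s e = v) → C (f v) (∑ e ∈ (G.rowFinite v).toFinset, f (G.r e)))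
    {x y : G.V →₀ ℕ} (h : graphMk G x = graphMk G y) :
    C (Finsupp.liftAddHom (fun v => (multiplesHom N (f v))) x)
      (Finsupp.liftAddHom (fun v => (multiplesHom N (f v))) y) := by
  have hle : addConGen (graphRel G) ≤
      C.comap (Finsupp.liftAddHom (fun v => (multiplesHom N (f v)))) (map_add _) := by
    refine AddCon.addConGen_le.2 ?_
    rintro x y ⟨v, hv, rfl, rfl⟩
    simpa [AddCon.comap_rel, map_sum] using hf v hv
  exact hle ((addConGen (graphRel G)).eq.1 h)

variable (ε : Mpab ≃+ graphMonoid G)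

/-- A word representing a vertex of the graph in `Mpab`. -/
noncomputable def vertexWord (v : G.V) : Fin 3 →₀ ℕ :=
  (pabMk_surjective (ε.symm (vertexElem G v))).choose

theorem pabMk_vertexWord (v : G.V) : pabMk (vertexWord ε v) = ε.symm (vertexElem G v) :=
  (pabMk_surjective (ε.symm (vertexElem G v))).choose_spec

theorem vertexWord_relation {v : G.V} (hv : ∃ e, G.s e = v) :
    vertexWord ε v 0 = ∑ e ∈ (G.rowFinite v).toFinset, vertexWord ε (G.r e) 0 ∧
      (vertexWord ε v 0 = 0 →
        vertexWord ε v = ∑ e ∈ (G.rowFinite v).toFinset, vertexWord ε (G.r e)) := by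
  have h : pabMk (vertexWord ε v) =
      pabMk (∑ e ∈ (G.rowFinite v).toFinset, vertexWord ε (G.r e)) := by
    rw [map_sum, pabMk_vertexWord, vertexElem_eq_sum hv, map_sum]
    exact Finset.sum_congr rfl fun e _ => (pabMk_vertexWord ε _).symm
  rwa [pabMk_eq_iff, Finsupp.finsetSum_apply] at h

/-- Every generator of `Mpab` is the class of a vertex. -/
theorem exists_vertexWord (t : Fin 3) :
    ∃ v, vertexWord ε v t = 1 ∧ (t ≠ 0 → vertexWord ε v = Finsupp.single t 1) := by
  obtain ⟨y, hy⟩ := graphMk_surjective (ε (pabMk (Finsupp.single t 1)))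
  have hrep : pabMk (y.sum fun v k => k • vertexWord ε v) = pabMk (Finsupp.single t 1) := by
    apply ε.injective
    rw [← hy]
    conv_rhs => rw [← y.sum_single]
    simp only [Finsupp.sum, map_sum, map_nsmul, pabMk_vertexWord, AddEquiv.apply_symm_apply,
      graphMk_single]
  rw [pabMk_eq_iff] at hrep
  have hcoord : ∀ s, (y.sum fun v k => k • vertexWord ε v) s =
      ∑ v ∈ y.support, y v * vertexWord ε v s := by
    intro s
    simp [Finsupp.sum, Finsupp.finsetSum_apply]
  have ht : ∑ v ∈ y.support, y v * vertexWord ε v t = 1 := by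
    rw [← hcoord]
    by_cases h : t = 0
    · subst h
      simpa using hrep.1
    · have h0 := hrep.2 (by rw [hrep.1]; simp [h])
      rw [h0]
      simp
  obtain ⟨v, hv, hne⟩ := Finset.exists_ne_zero_of_sum_ne_zero (ht.trans_ne one_ne_zero)
  have hle := Finset.single_le_sum (f := fun v => y v * vertexWord ε v t)
    (fun _ _ => Nat.zero_le _) hv
  have h1 : y v * vertexWord ε v t = 1 := le_antisymm (ht ▸ hle) (Nat.pos_of_ne_zero hne)
  refine ⟨v, Nat.eq_one_of_mul_eq_one_left h1, fun h => Finsupp.ext fun s => ?_⟩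
  by_cases hs : s = t
  · subst hs
    simpa using Nat.eq_one_of_mul_eq_one_left h1
  · have h0 := hrep.2 (by rw [hrep.1]; simp [h])
    have hs0 : ∑ v ∈ y.support, y v * vertexWord ε v s = 0 := by
      rw [← hcoord, h0]
      simp [hs]
    have := (Finset.sum_eq_zero_iff.1 hs0) v hv
    rcases Nat.mul_eq_zero.1 this with h' | h'
    · exact absurd h' (Finsupp.mem_support_iff.1 hv)
    · rw [h', Finsupp.single_eq_of_ne hs]

/-- A vertex of degree one emits exactly one edge to a vertex of degree one, unless it is a sink. -/
theorem exists_next (v : G.V) : ∃ (n : G.V) (c : ℤ × ℤ),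
    vertexWord ε v 0 = 1 → (∃ e, G.s e = v) → vertexWord ε n 0 = 1 ∧
      ∃ e₀ ∈ (G.rowFinite v).toFinset, G.r e₀ = n ∧
        (∀ e ∈ (G.rowFinite v).toFinset, e ≠ e₀ → vertexWord ε (G.r e) 0 = 0) ∧
        ∀ l₁ l₂ : ℤ, ∀ g : G.E → ℤ,
          (∀ e, vertexWord ε (G.r e) 0 = 0 →
            g e = l₁ * vertexWord ε (G.r e) 1 + l₂ * vertexWord ε (G.r e) 2) →
          ∑ e ∈ (G.rowFinite v).toFinset, g e = g e₀ + (l₁ * c.1 + l₂ * c.2) := by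
  classical
  by_cases h : vertexWord ε v 0 = 1 ∧ ∃ e, G.s e = v
  swap
  · exact ⟨v, 0, fun h1 h2 => absurd ⟨h1, h2⟩ h⟩
  obtain ⟨h1, hv⟩ := h
  have hsum := (vertexWord_relation ε hv).1
  rw [h1] at hsum
  obtain ⟨e₀, he₀, hne⟩ := Finset.exists_ne_zero_of_sum_ne_zero (hsum.symm.trans_ne one_ne_zero)
  rw [← Finset.add_sum_erase _ _ he₀] at hsum
  have hz : ∑ e ∈ (G.rowFinite v).toFinset.erase e₀, vertexWord ε (G.r e) 0 = 0 := by omega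
  have hz' : ∀ e ∈ (G.rowFinite v).toFinset, e ≠ e₀ → vertexWord ε (G.r e) 0 = 0 :=
    fun e he hne => Finset.sum_eq_zero_iff.1 hz e (Finset.mem_erase.2 ⟨hne, he⟩)
  refine ⟨G.r e₀, (∑ e ∈ (G.rowFinite v).toFinset.erase e₀, (vertexWord ε (G.r e) 1 : ℤ),
    ∑ e ∈ (G.rowFinite v).toFinset.erase e₀, (vertexWord ε (G.r e) 2 : ℤ)),
    fun _ _ => ⟨by omega, e₀, he₀, rfl, hz', fun l₁ l₂ g hg => ?_⟩⟩
  rw [← Finset.add_sum_erase _ _ he₀, Finset.mul_sum, Finset.mul_sum, ← Finset.sum_add_distrib]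
  congr 1
  refine Finset.sum_congr rfl fun e he => hg e ?_
  exact hz' e (Finset.mem_of_mem_erase he) (Finset.ne_of_mem_erase he)

end Graph

theorem Mpab_not_isGraphMonoid : ¬ IsGraphMonoid Mpab := by
  classical
  rintro ⟨G, ⟨ε⟩⟩
  choose n c hnc using exists_next ε
  obtain ⟨v₀, hv₀, -⟩ := exists_vertexWord ε 0
  obtain ⟨m, l₁, l₂, hl, hH⟩ := exists_functional (n := n) c v₀
  obtain ⟨g, hg⟩ := exists_potential _ _ hH
  set T : Set G.V := {v | ∃ k l, n^[k] v = n^[l] (n^[m] v₀)}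
  have hTn : ∀ v, n v ∈ T → v ∈ T := fun v ⟨k, l, h⟩ => ⟨k + 1, l, h⟩
  have hv₀T : v₀ ∈ T := ⟨m, 0, rfl⟩
  have hTn' : ∀ v, v ∈ T → n v ∈ T := by
    rintro v ⟨k, l, h⟩
    refine ⟨k, l + 1, ?_⟩
    rw [← Function.iterate_succ_apply, Function.iterate_succ_apply', h,
      ← Function.iterate_succ_apply' n l]
  let f : G.V → ℕ × ℤ := fun v =>
    if vertexWord ε v 0 = 0 then (0, l₁ * vertexWord ε v 1 + l₂ * vertexWord ε v 2)
    else if vertexWord ε v 0 = 1 ∧ v ∈ T then (1, g v) else (2, 0)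
  have f_zero : ∀ v, vertexWord ε v 0 = 0 →
      f v = (0, l₁ * vertexWord ε v 1 + l₂ * vertexWord ε v 2) := fun v h => if_pos h
  have f_one : ∀ v, vertexWord ε v 0 = 1 → v ∈ T → f v = (1, g v) := by
    intro v h h'
    simp [f, h, h']
  have f_two : ∀ v, vertexWord ε v 0 = 1 → v ∉ T → f v = (2, 0) := by
    intro v h h'
    simp [f, h, h']
  have f_large : ∀ v, 2 ≤ vertexWord ε v 0 → f v = (2, 0) := by
    intro v h
    simp only [f]
    rw [if_neg (by omega), if_neg (by omega)]
  have f_le : ∀ v, vertexWord ε v 0 ≤ 1 → vertexWord ε v 0 ≤ (f v).1 := by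
    intro v h
    simp only [f]
    split_ifs <;> simp <;> omega
  have hf : ∀ v, (∃ e, G.s e = v) →
      truncCon (f v) (∑ e ∈ (G.rowFinite v).toFinset, f (G.r e)) := by
    intro v hv
    obtain ⟨hsum, hsum'⟩ := vertexWord_relation ε hv
    rw [truncCon_iff]
    rcases Nat.lt_or_ge (vertexWord ε v 0) 2 with hlt | hge
    · rcases (by omega : vertexWord ε v 0 = 0 ∨ vertexWord ε v 0 = 1) with h0 | h1
      · left
        have hz := Finset.sum_eq_zero_iff.1 (hsum.symm.trans h0)
        rw [f_zero v h0, Finset.sum_congr rfl fun e he => f_zero (G.r e) (hz e he), hsum' h0]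
        ext
        · simp [Prod.fst_sum]
        · simp [Prod.snd_sum, Finsupp.finsetSum_apply, Finset.sum_add_distrib, Finset.mul_sum]
      · obtain ⟨hn, e₀, he₀, hre₀, hz, hsumg⟩ := hnc v h1 hv
        have hfst : (∑ e ∈ (G.rowFinite v).toFinset, f (G.r e)).1 = (f (n v)).1 := by
          rw [Prod.fst_sum, ← hre₀, Finset.sum_eq_single_of_mem e₀ he₀]
          intro e he hne
          rw [f_zero _ (hz e he hne)]
        by_cases hvT : v ∈ T
        · left
          ext
          · rw [hfst, f_one v h1 hvT, f_one _ hn (hTn' v hvT)]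
          · rw [Prod.snd_sum, hsumg l₁ l₂ (fun e => (f (G.r e)).2)
              (fun e he => by rw [f_zero _ he]), hre₀, f_one v h1 hvT, f_one _ hn (hTn' v hvT)]
            exact hg v hvT
        · right
          rw [hfst, f_two v h1 hvT, f_two _ hn (fun h => hvT (hTn v h))]
          simp
    · right
      refine ⟨by rw [f_large v hge], ?_⟩
      rw [Prod.fst_sum]
      by_cases hbig : ∃ e ∈ (G.rowFinite v).toFinset, 2 ≤ vertexWord ε (G.r e) 0
      · obtain ⟨e, he, h2⟩ := hbig
        have := Finset.single_le_sum (f := fun e => (f (G.r e)).1) (fun _ _ => Nat.zero_le _) he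
        simp only [f_large _ h2] at this
        exact this
      · push Not at hbig
        rw [hsum] at hge
        exact hge.trans (Finset.sum_le_sum fun e he => f_le _ (by have := hbig e he; omega))
  have absorb : ∀ v, vertexWord ε v 0 = 0 →
      l₁ * vertexWord ε v 1 + l₂ * vertexWord ε v 2 = 0 := by
    intro v hv
    have h : pabMk (vertexWord ε v₀) = pabMk (vertexWord ε v₀ + vertexWord ε v) := by
      rw [pabMk_eq_iff]
      simp [hv₀, hv]
    rw [map_add, pabMk_vertexWord, pabMk_vertexWord, ← map_add] at h
    have h' : graphMk G (Finsupp.single v₀ 1) =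
        graphMk G (Finsupp.single v₀ 1 + Finsupp.single v 1) := by
      simpa [graphMk_single] using ε.symm.injective h
    have h2 := con_of_graphMk_eq truncCon f hf h'
    rw [truncCon_iff] at h2
    simpa [f_zero v hv, f_one v₀ hv₀ hv₀T] using h2
  obtain ⟨va, -, hva⟩ := exists_vertexWord ε 1
  obtain ⟨vb, -, hvb⟩ := exists_vertexWord ε 2
  have ha := absorb va (by rw [hva (by decide)]; simp)
  have hb := absorb vb (by rw [hvb (by decide)]; simp)
  rw [hva (by decide)] at ha
  rw [hvb (by decide)] at hb
  exact hl ⟨by simpa using ha, by simpa using hb⟩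

/-- The monoid `M = ⟨p, a, b ∣ p = p + a, p = p + b⟩` is a finitely
generated conical refinement monoid which is not a graph monoid. -/
theorem Mpab_not_graphMonoid :
    AddMonoid.FG Mpab ∧ IsConical Mpab ∧ IsRefinement Mpab ∧ ¬ IsGraphMonoid Mpab :=
  ⟨Mpab_fg, Mpab_isConical, Mpab_isRefinement, Mpab_not_isGraphMonoid⟩

end ArPardo
end
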